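/- If A in {1,2}^Z is a bi-infinite sequence with Markov value m(A) < C_inf, then neither the word 1_3 2_4 1 2_2 1_2 2_4 1 2_2 1_2 2_4 1 2_2 1_2 2_2 nor its transpose occurs as a consecutive subword of A. -/

import Mathlib

open Filter Set

/-- Convergents of the continued fraction `[a 0; a 1, a 2, ...]`. -/
noncomputable def cfConv : (ℕ → ℕ) → ℕ → ℝ
  | a, 0 => (a 0 : ℝ)
  | a, n + 1 => (a 0 : ℝ) + 1 / cfConv (fun i => a (i + 1)) n

/-- Value of the infinite continued fraction `[a 0; a 1, a 2, ...]`,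
i.e. the limit of its convergents. -/
noncomputable def cfVal (a : ℕ → ℕ) : ℝ := limUnder atTop (cfConv a)

/-- Value of the infinite continued fraction `[0; g 0, g 1, g 2, ...]`. -/
noncomputable def cf0 (g : ℕ → ℕ) : ℝ :=
  cfVal (fun n => match n with | 0 => 0 | k + 1 => g k)

/-- `λ_i(A) = [a_i; a_{i+1}, ...] + [0; a_{i-1}, a_{i-2}, ...]` for a bi-infinite
sequence `A`. -/
noncomputable def lam (A : ℤ → ℕ) (i : ℤ) : ℝ :=
  cfVal (fun n => A (i + n)) + cf0 (fun k => A (i - 1 - k))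

/-- The Markov value `m(A) = sup_i λ_i(A)`. -/
noncomputable def markovVal (A : ℤ → ℕ) : ℝ := sSup (Set.range (lam A))

/-- The Lagrange value `ℓ(A) = limsup_{i → +∞} λ_i(A)`. -/
noncomputable def lagrangeVal (A : ℤ → ℕ) : ℝ := limsup (lam A) atTop

/-- The Markov spectrum (Perron's characterization). -/
def MarkovSpectrum : Set ℝ :=
  {x | ∃ A : ℤ → ℕ, (∀ n, 0 < A n) ∧ BddAbove (Set.range (lam A)) ∧ x = markovVal A}

/-- The Lagrange spectrum (Perron's characterization). -/
def LagrangeSpectrum : Set ℝ :=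
  {x | ∃ A : ℤ → ℕ, (∀ n, 0 < A n) ∧ IsBoundedUnder (· ≤ ·) atTop (lam A) ∧
    x = lagrangeVal A}

/-- The purely periodic one-sided sequence with period `w`. -/
def perSeq (w : List ℕ) : ℕ → ℕ := fun n => w.getD (n % w.length) 1

/-- The one-sided sequence beginning with the finite word `p` and continuing with `g`. -/
def catSeq (p : List ℕ) (g : ℕ → ℕ) : ℕ → ℕ :=
  fun n => if n < p.length then p.getD n 1 else g (n - p.length)

/-- The eventually periodic one-sided sequence with preperiod `p` and period `w`. -/
def prePer (p w : List ℕ) : ℕ → ℕ := catSeq p (perSeq w)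

/-- The periodic bi-infinite sequence with period `w`. -/
def perZ (w : List ℕ) : ℤ → ℕ := fun n => w.getD ((n % (w.length : ℤ)).toNat) 1

/-- `c_∞ = [overline(2_4 1_2 2_2 1)] + [0; overline(1 2_2 1_2 2_4)]`. -/
noncomputable def cInf : ℝ :=
  cfVal (perSeq [2,2,2,2,1,1,2,2,1]) + cf0 (perSeq [1,2,2,1,1,2,2,2,2])

/-- `C_∞ = [2; 1, 2_2, 1_2, 2_4, 1, 2_2, 1_2, 2_4, 1, 2_2, 1_2, 2_2, 1, 2_4, 1_2,
overline(2_3 1_3)] + [0; 2_3, 1_2, 2_2, 1, 2_4, 1, overline(1_3 2_3)]`. -/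
noncomputable def CInf : ℝ :=
  cfVal (prePer [2,1,2,2,1,1,2,2,2,2,1,2,2,1,1,2,2,2,2,1,2,2,1,1,2,2,1,2,2,2,2,1,1]
    [2,2,2,1,1,1]) +
  cf0 (prePer [2,2,2,1,1,2,2,1,2,2,2,2,1] [1,1,1,2,2,2])

/-- `f = [overline(2_4 1_2 2_2 1)] + [0; 1, 2_2, 1_2, 2_4, 1, 2_2, 1_2, 2_2, 1_2,
overline(2_3 1_3)]`. -/
noncomputable def fV : ℝ :=
  cfVal (perSeq [2,2,2,2,1,1,2,2,1]) +
  cf0 (prePer [1,2,2,1,1,2,2,2,2,1,2,2,1,1,2,2,1,1] [2,2,2,1,1,1])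

/-- `w` occurs in the bi-infinite sequence `A` starting at position `j`. -/
def occursAtZ (w : List ℕ) (A : ℤ → ℕ) (j : ℤ) : Prop :=
  ∀ i : ℕ, i < w.length → A (j + i) = w.getD i 0

/-- `w` occurs somewhere in the bi-infinite sequence `A`. -/
def occursInZ (w : List ℕ) (A : ℤ → ℕ) : Prop := ∃ j : ℤ, occursAtZ w A j

/-- `w` occurs in the one-sided sequence `g` starting at position `k`. -/
def occursAtN (w : List ℕ) (g : ℕ → ℕ) (k : ℕ) : Prop :=
  ∀ i : ℕ, i < w.length → g (k + i) = w.getD i 0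

/-- `w` occurs somewhere in the one-sided sequence `g`. -/
def occursInN (w : List ℕ) (g : ℕ → ℕ) : Prop := ∃ k : ℕ, occursAtN w g k

def W1 : List ℕ := [1,2,1]
def W2 : List ℕ := [2,2,1,2,2,2,1]
def W3 : List ℕ := [2,2,2,1,2,2,2]
def W4 : List ℕ := [2,2,2,2,2,1,2,2,1,1]
def W5 : List ℕ := [2,2,2,1,1,2,2,2,2,1,2,2,1,1,2,2,2]
def W6 : List ℕ := [2,2,1,1,2,2,2,2,1,2,2,1,1,2,2,2,1]
def W7 : List ℕ := [1,1,2,2,1,1,2,2,2,2,1,2,2,1,1,2,2,2]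
def W8 : List ℕ := [2,2,1,2,2,1,1,2,2,2,2,1,2,2,1,1,2,2,2,2,2]
def W9 : List ℕ := [1,2,2,1,2,2,1,1,2,2,2,2,1,2,2,1,1,2,2,2,2,1]
def W10 : List ℕ := [2,2,2,2,1,2,2,1,1,2,2,2,2,1,2,2,1,1,2,2,2,2,1,1]
def W11 : List ℕ := [2,2,2,2,1,2,2,1,1,2,2,2,2,1,2,2,1,1,2,2,2,2,1,2,2,1,2]
def W12 : List ℕ := [1,2,2,2,2,1,2,2,1,1,2,2,2,2,1,2,2,1,1,2,2,2,2,1,2,2,1,1,1]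
def W13 : List ℕ := [2,1,2,2,2,2,1,2,2,1,1,2,2,2,2,1,2,2,1,1,2,2,2,2,1,2,2,1,1,2,2]

/-- The list of the thirteen words `W_1, …, W_13`. -/
def Wall : List (List ℕ) := [W1,W2,W3,W4,W5,W6,W7,W8,W9,W10,W11,W12,W13]

/-- The words `W_1, …, W_13` together with the (0-based) position of their marked
digit `2^*`. -/
def markedW : List (List ℕ × ℕ) :=
  [(W1,1),(W2,3),(W3,4),(W4,4),(W5,8),(W6,7),(W7,9),(W8,10),(W9,11),(W10,12),
   (W11,12),(W12,13),(W13,14)]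

/-- The words `V_15, …, V_21` together with the (0-based) position of their marked
digit `2^*`. -/
def markedV : List (List ℕ × ℕ) :=
  [([1,1,2,2],2),
   ([2,2,1,2,2,1],3),
   ([2,2,2,2,1,2,2,1,2],3),
   ([1,2,2,2,2,1,2,2,1,1,1],4),
   ([1,2,2,2,2,1,2,2,1,1,2,2,1],4),
   ([2,1,2,2,2,2,1,2,2,1,1,2,2,2],5),
   ([1,1,1,2,2,2,2,1,2,2,1,1,2,2,2],6)]

/-- The word `2 1_2 2_4 1 2_2 1_2 2_3`. -/
def spWord : List ℕ := [2,1,1,2,2,2,2,1,2,2,1,1,2,2,2]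

/-- The set `P` of 27 forbidden words: `W_1, …, W_13`, their transposes, and
`2 1_2 2_4 1 2_2 1_2 2_3` together with its transpose. -/
def Pwords : List (List ℕ) := Wall ++ Wall.map List.reverse ++ [spWord, spWord.reverse]

/-- `g` contains no word of `P` as a consecutive subword. -/
def avoidsP (g : ℕ → ℕ) : Prop := ∀ w ∈ Pwords, ¬ occursInN w g

/-- The Cantor set `Y`. -/
noncomputable def Yset : Set ℝ :=
  {x | ∃ g : ℕ → ℕ, (∀ n, g n = 1 ∨ g n = 2) ∧ avoidsP g ∧ x = cf0 g}

/-- The word `1_2 2_4 1 2_2 1_2 2_4 1 2_2 1_2 2_4 1 2_2 1_2 2_2`. -/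
def bigWord : List ℕ :=
  [1,1,2,2,2,2,1,2,2,1,1,2,2,2,2,1,2,2,1,1,2,2,2,2,1,2,2,1,1,2,2]

/-- The word `1_3 2_4 1 2_2 1_2 2_4 1 2_2 1_2 2_4 1 2_2 1_2 2_2`. -/
def bigWord13 : List ℕ := 1 :: bigWord

/-- `g` is an infinite concatenation of the blocks `(1,1)` and `(2,2)`. -/
def isBlockSeq (g : ℕ → ℕ) : Prop :=
  ∀ n, (g (2*n) = 1 ∧ g (2*n+1) = 1) ∨ (g (2*n) = 2 ∧ g (2*n+1) = 2)

/-- The Gauss–Cantor set `K({1_2, 2_2})`. -/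
noncomputable def Kset : Set ℝ := {x | ∃ g : ℕ → ℕ, isBlockSeq g ∧ x = cf0 g}

/-- A sequence all of whose entries are `1` or `2`. -/
def IsDigitSeq (a : ℕ → ℕ) : Prop := ∀ n, a n = 1 ∨ a n = 2

lemma IsDigitSeq.shift {a : ℕ → ℕ} (ha : IsDigitSeq a) : IsDigitSeq (fun i => a (i + 1)) :=
  fun n => ha (n + 1)

lemma IsDigitSeq.one_le {a : ℕ → ℕ} (ha : IsDigitSeq a) (n : ℕ) : (1 : ℝ) ≤ a n := by
  rcases ha n with h | h <;> norm_num [h]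

lemma IsDigitSeq.le_two {a : ℕ → ℕ} (ha : IsDigitSeq a) (n : ℕ) : (a n : ℝ) ≤ 2 := by
  rcases ha n with h | h <;> norm_num [h]

lemma cfConv_mem_Icc (n : ℕ) : ∀ {a : ℕ → ℕ}, IsDigitSeq a → cfConv a n ∈ Set.Icc (1 : ℝ) 3 := by
  induction n with
  | zero =>
    intro a ha
    have h1 := ha.one_le 0
    have h2 := ha.le_two 0
    simp only [cfConv]
    constructor <;> linarith
  | succ n ih =>
    intro a ha
    obtain ⟨h1, h2⟩ := ih ha.shift
    have h3 := ha.one_le 0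
    have h4 := ha.le_two 0
    have h5 : 0 < 1 / cfConv (fun i => a (i + 1)) n := by positivity
    have h6 : 1 / cfConv (fun i => a (i + 1)) n ≤ 1 := by
      rw [div_le_one (by linarith)]; exact h1
    simp only [cfConv]
    constructor <;> linarith

lemma four_thirds_le_cfConv {a : ℕ → ℕ} (ha : IsDigitSeq a) (n : ℕ) :
    4 / 3 ≤ cfConv a (n + 1) := by
  obtain ⟨h1, h2⟩ := cfConv_mem_Icc n ha.shift
  have h3 := ha.one_le 0
  have h4 : 1 / 3 ≤ 1 / cfConv (fun i => a (i + 1)) n :=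
    one_div_le_one_div_of_le (by linarith) h2
  simp only [cfConv]
  linarith

lemma dist_cfConv_succ_le (n : ℕ) : ∀ {a : ℕ → ℕ}, IsDigitSeq a →
    dist (cfConv a n) (cfConv a (n + 1)) ≤ 4 * (9 / 16 : ℝ) ^ n := by
  induction n with
  | zero =>
    intro a ha
    obtain ⟨h1, h2⟩ := cfConv_mem_Icc 0 ha
    obtain ⟨h3, h4⟩ := cfConv_mem_Icc 1 ha
    rw [Real.dist_eq, abs_le]
    constructor <;> norm_num <;> linarith
  | succ n ih =>
    intro a ha
    cases n with
    | zero =>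
      obtain ⟨h1, h2⟩ := cfConv_mem_Icc 1 ha
      obtain ⟨h3, h4⟩ := cfConv_mem_Icc 2 ha
      rw [Real.dist_eq, abs_le]
      constructor <;> norm_num <;> linarith
    | succ n =>
      have h := ih ha.shift
      have hx := four_thirds_le_cfConv ha.shift n
      have hy := four_thirds_le_cfConv ha.shift (n + 1)
      change dist ((a 0 : ℝ) + 1 / cfConv (fun i => a (i + 1)) (n + 1))
        (a 0 + 1 / cfConv (fun i => a (i + 1)) (n + 1 + 1)) ≤ _
      set x := cfConv (fun i => a (i + 1)) (n + 1)
      set y := cfConv (fun i => a (i + 1)) (n + 1 + 1)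
      have hxy : 16 / 9 ≤ x * y := by nlinarith
      have hdist : dist ((a 0 : ℝ) + 1 / x) (a 0 + 1 / y) = dist x y / (x * y) := by
        have hx0 : x ≠ 0 := by linarith
        have hy0 : y ≠ 0 := by linarith
        rw [Real.dist_eq, Real.dist_eq, abs_sub_comm x y,
          show (a 0 : ℝ) + 1 / x - (a 0 + 1 / y) = (y - x) / (x * y) by field_simp; ring,
          abs_div, abs_of_pos (by linarith : 0 < x * y)]
      rw [hdist, div_le_iff₀ (by linarith), pow_succ]
      have hp : (0 : ℝ) < (9 / 16) ^ (n + 1) := by positivity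
      nlinarith

lemma tendsto_cfConv {a : ℕ → ℕ} (ha : IsDigitSeq a) :
    Tendsto (cfConv a) atTop (nhds (cfVal a)) :=
  (cauchySeq_of_le_geometric _ _ (by norm_num) fun n => dist_cfConv_succ_le n ha).tendsto_limUnder

lemma cfVal_mem_Icc {a : ℕ → ℕ} (ha : IsDigitSeq a) : cfVal a ∈ Set.Icc (1 : ℝ) 3 :=
  isClosed_Icc.mem_of_tendsto (tendsto_cfConv ha)
    (Eventually.of_forall fun n => cfConv_mem_Icc n ha)

lemma cfVal_pos {a : ℕ → ℕ} (ha : IsDigitSeq a) : 0 < cfVal a := by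
  linarith [(cfVal_mem_Icc ha).1]

lemma cfVal_eq_add {a : ℕ → ℕ} (ha : IsDigitSeq fun i => a (i + 1)) :
    cfVal a = a 0 + 1 / cfVal (fun i => a (i + 1)) := by
  have h : Tendsto (fun n => cfConv a (n + 1)) atTop
      (nhds (a 0 + 1 / cfVal (fun i => a (i + 1)))) := by
    simp only [cfConv]
    exact tendsto_const_nhds.add (tendsto_const_nhds.div (tendsto_cfConv ha) (cfVal_pos ha).ne')
  exact ((tendsto_add_atTop_iff_nat 1).1 h).limUnder_eq

lemma cf0_eq {g : ℕ → ℕ} (hg : IsDigitSeq g) : cf0 g = 1 / cfVal g := by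
  rw [cf0, cfVal_eq_add (by exact hg)]
  simp

lemma cfVal_mem_Icc_four_thirds {a : ℕ → ℕ} (ha : IsDigitSeq a) :
    cfVal a ∈ Set.Icc (4 / 3 : ℝ) (11 / 4) := by
  have lower : ∀ {b : ℕ → ℕ}, IsDigitSeq b → 4 / 3 ≤ cfVal b := fun hb =>
    ge_of_tendsto ((tendsto_add_atTop_iff_nat 1).2 (tendsto_cfConv hb))
      (Eventually.of_forall fun n => four_thirds_le_cfConv hb n)
  refine ⟨lower ha, ?_⟩
  have h1 := one_div_le_one_div_of_le (by norm_num) (lower ha.shift)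
  rw [cfVal_eq_add ha.shift]
  linarith [ha.le_two 0]

/-- If, at the first place where `a` differs from `b`, the digit of `a` pushes the value of the
continued fraction down, then `[a 0; a 1, ...] ≤ [b 0; b 1, ...]`. -/
lemma cfVal_le_cfVal_of_first_diff {a b : ℕ → ℕ} (ha : IsDigitSeq a) (hb : IsDigitSeq b)
    (h : ∀ n, (∀ i < n, a i = b i) → a n ≠ b n → (Even n ↔ a n < b n)) :
    cfVal a ≤ cfVal b := by
  by_cases hab : a = b
  · rw [hab]
  have hex : ∃ n, a n ≠ b n := Function.ne_iff.1 hab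
  classical
  have hn := Nat.find_spec hex
  have hlt : ∀ i < Nat.find hex, a i = b i := fun i hi => not_not.1 (Nat.find_min hex hi)
  have hpar := h _ hlt hn
  generalize Nat.find hex = n at hn hlt hpar
  clear h hab hex
  have head : ∀ {c d : ℕ → ℕ}, IsDigitSeq c → IsDigitSeq d → c 0 < d 0 → cfVal c ≤ cfVal d := by
    intro c d hc hd hcd
    rw [cfVal_eq_add hc.shift, cfVal_eq_add hd.shift]
    have h1 : 1 / cfVal (fun i => c (i + 1)) ≤ 1 := by
      rw [div_le_one (cfVal_pos hc.shift)]; exact (cfVal_mem_Icc hc.shift).1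
    have h2 : 0 < 1 / cfVal (fun i => d (i + 1)) := one_div_pos.2 (cfVal_pos hd.shift)
    have h3 : (c 0 : ℝ) + 1 ≤ d 0 := by exact_mod_cast hcd
    linarith
  have key : ∀ n : ℕ, ∀ {c d : ℕ → ℕ}, IsDigitSeq c → IsDigitSeq d → (∀ i < n, c i = d i) →
      c n < d n → if Even n then cfVal c ≤ cfVal d else cfVal d ≤ cfVal c := by
    intro n
    induction n with
    | zero => intro c d hc hd _ hlt; simpa using head hc hd hlt
    | succ n ih =>
      intro c d hc hd heq hlt
      have := ih hc.shift hd.shift (fun i hi => heq (i + 1) (by omega)) hlt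
      rw [cfVal_eq_add hc.shift, cfVal_eq_add hd.shift, heq 0 (by omega)]
      by_cases he : Even n
      · rw [if_pos he] at this
        rw [if_neg (by simpa [Nat.even_add_one] using he)]
        gcongr
        exact cfVal_pos hc.shift
      · rw [if_neg he] at this
        rw [if_pos (by simpa [Nat.even_add_one] using he)]
        gcongr
        exact cfVal_pos hd.shift
  by_cases he : Even n
  · simpa [he] using key n ha hb hlt (hpar.1 he)
  · have : b n < a n := lt_of_le_of_ne (not_lt.1 fun h => he (hpar.2 h)) hn.symm
    simpa [he] using key n hb ha (fun i hi => (hlt i hi).symm) this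

/-- Upper (`true`) and lower (`false`) bounds for the continued fractions with digits in `{1, 2}`
whose digits start with the given word. -/
def cfBound : Bool → List ℕ → ℚ
  | true, [] => 11 / 4
  | false, [] => 4 / 3
  | true, d :: l => d + 1 / cfBound false l
  | false, d :: l => d + 1 / cfBound true l

lemma cfBound_pos (l : List ℕ) : 0 < cfBound true l ∧ 0 < cfBound false l := by
  induction l with
  | nil => norm_num [cfBound]
  | cons d l ih =>
    obtain ⟨h1, h2⟩ := ih
    constructor <;> simp only [cfBound] <;> positivity

lemma cfVal_mem_cfBound (l : List ℕ) : ∀ {a : ℕ → ℕ}, IsDigitSeq a →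
    (∀ i < l.length, a i = l.getD i 0) →
    (cfBound false l : ℝ) ≤ cfVal a ∧ cfVal a ≤ cfBound true l := by
  induction l with
  | nil => intro a ha _; simpa [cfBound] using cfVal_mem_Icc_four_thirds ha
  | cons d l ih =>
    intro a ha h
    obtain ⟨h1, h2⟩ := ih ha.shift fun i hi => by
      simpa using h (i + 1) (by simpa using hi)
    have h0 : a 0 = d := by simpa using h 0 (by simp)
    have hpos : (0 : ℝ) < cfBound false l := by exact_mod_cast (cfBound_pos l).2
    have hV := cfVal_pos ha.shift
    rw [cfVal_eq_add ha.shift, h0]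
    simp only [cfBound]
    push_cast
    constructor <;> gcongr

/-- A bi-infinite sequence over `{1, 2}` all of whose values `λ_i` are below `C_∞`. -/
def IsBelowCInf (A : ℤ → ℕ) : Prop := (∀ n, A n = 1 ∨ A n = 2) ∧ ∀ i, lam A i < CInf

lemma lam_eq {A : ℤ → ℕ} (hA : ∀ n, A n = 1 ∨ A n = 2) (i : ℤ) :
    lam A i = A i + 1 / cfVal (fun n => A (i + 1 + n)) + 1 / cfVal (fun n => A (i - 1 - n)) := by
  have hR : (fun n : ℕ => A (i + (n + 1 : ℕ))) = fun n : ℕ => A (i + 1 + n) := by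
    funext n; congr 1; push_cast; ring
  rw [lam, cf0_eq fun n => hA _, cfVal_eq_add fun n => hA _, hR]
  simp

lemma IsBelowCInf.translate {A : ℤ → ℕ} (hA : IsBelowCInf A) (c : ℤ) :
    IsBelowCInf fun n => A (c + n) := by
  have hd : ∀ n, A (c + n) = 1 ∨ A (c + n) = 2 := fun n => hA.1 _
  refine ⟨hd, fun i => ?_⟩
  convert hA.2 (c + i) using 1
  rw [lam_eq hd, lam_eq hA.1]
  simp only [add_assoc, add_sub_assoc]

lemma IsBelowCInf.reflect {A : ℤ → ℕ} (hA : IsBelowCInf A) (c : ℤ) :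
    IsBelowCInf fun n => A (c - n) := by
  have hd : ∀ n, A (c - n) = 1 ∨ A (c - n) = 2 := fun n => hA.1 _
  refine ⟨hd, fun i => ?_⟩
  convert hA.2 (c - i) using 1
  rw [lam_eq hd, lam_eq hA.1, add_right_comm]
  have h1 : (fun n : ℕ => A (c - (i + 1 + n))) = fun n : ℕ => A (c - i - 1 - n) := by
    funext n; congr 1; ring
  have h2 : (fun n : ℕ => A (c - (i - 1 - n))) = fun n : ℕ => A (c - i + 1 + n) := by
    funext n; congr 1; ring
  rw [h1, h2]

/-- The digits preceding the marked digit `2` of `bigWord13`, read from right to left and continued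
by the left tail of `C_∞`. -/
def leftTail : ℕ → ℕ := prePer [2,2,2,1,1,2,2,1,2,2,2,2,1] [1,1,1,2,2,2]

/-- The digits of `bigWord13`, continued after its marked digit by the right tail of `C_∞`. -/
def rightExt : ℕ → ℕ := prePer
  [1,1,1,2,2,2,2,1,2,2,1,1,2,2,2,2,1,2,2,1,1,2,2,2,2,
     1,2,2,1,1,2,2,2,2,1,2,2,1,1,2,2,1,2,2,2,2,1,1]
  [2,2,2,1,1,1]

lemma isDigitSeq_perSeq {w : List ℕ} (hw : ∀ d ∈ w, d = 1 ∨ d = 2) :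
    IsDigitSeq (perSeq w) := by
  intro n
  rw [perSeq, List.getD_eq_getElem?_getD]
  rcases h : w[n % w.length]? with _ | d
  · simp
  · simpa using hw d (List.mem_of_getElem? h)

lemma isDigitSeq_prePer {p w : List ℕ} (hp : ∀ d ∈ p, d = 1 ∨ d = 2)
    (hw : ∀ d ∈ w, d = 1 ∨ d = 2) : IsDigitSeq (prePer p w) := by
  intro n
  rw [prePer, catSeq]
  split_ifs with h
  · rw [List.getD_eq_getElem _ _ h]
    exact hp _ (List.getElem_mem h)
  · exact isDigitSeq_perSeq hw _

lemma isDigitSeq_leftTail : IsDigitSeq leftTail :=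
  isDigitSeq_prePer (by decide) (by decide)

lemma isDigitSeq_rightExt : IsDigitSeq rightExt :=
  isDigitSeq_prePer (by decide) (by decide)

lemma prePer_add_period_mul (p w : List ℕ) (q n : ℕ) (hn : p.length ≤ n) :
    prePer p w (n + w.length * q) = prePer p w n := by
  rw [prePer, catSeq, catSeq, if_neg (by omega), if_neg (by omega), perSeq, perSeq,
    Nat.sub_add_comm hn, Nat.add_mul_mod_self_left]

lemma leftTail_add (q n : ℕ) (hn : 13 ≤ n) : leftTail (n + 6 * q) = leftTail n :=
  prePer_add_period_mul _ [1,1,1,2,2,2] q n hn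

lemma rightExt_add (q n : ℕ) (hn : 46 ≤ n) : rightExt (n + 6 * q) = rightExt n := by
  have h := prePer_add_period_mul
    [1,1,1,2,2,2,2,1,2,2,1,1,2,2,2,2,1,2,2,1,1,2,2,2,2,
     1,2,2,1,1,2,2,2,2,1,2,2,1,1,2,2,1,2,2,2,2]
    [1,1,2,2,2,1] q n hn
  have heq : prePer
    [1,1,1,2,2,2,2,1,2,2,1,1,2,2,2,2,1,2,2,1,1,2,2,2,2,
     1,2,2,1,1,2,2,2,2,1,2,2,1,1,2,2,1,2,2,2,2]
    [1,1,2,2,2,1] = rightExt := by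
    funext m
    by_cases hm : m < 48
    · interval_cases m <;> rfl
    · obtain ⟨k, r, hr, rfl⟩ : ∃ k r, r < 6 ∧ m = 48 + (r + 6 * k) :=
        ⟨(m - 48) / 6, (m - 48) % 6, Nat.mod_lt _ (by norm_num), by omega⟩
      have e1 : 48 + (r + 6 * k) - 48 = r + 6 * k := by omega
      have e2 : 48 + (r + 6 * k) - 46 = (2 + r) + 6 * k := by omega
      simp only [rightExt, prePer, catSeq, perSeq, List.length_cons, List.length_nil, Nat.zero_add,
        Nat.reduceAdd, e1, e2, Nat.add_mul_mod_self_left]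
      rw [if_neg (by omega), if_neg (by omega)]
      interval_cases r <;> rfl
  rwa [heq] at h

lemma CInf_eq :
    CInf = 2 + 1 / cfVal (fun n => rightExt (16 + n)) + 1 / cfVal leftTail := by
  have hR : (fun n => prePer [2,1,2,2,1,1,2,2,2,2,1,2,2,1,1,2,2,2,2,1,2,2,1,1,2,2,1,2,2,2,2,1,1]
      [2,2,2,1,1,1] (n + 1)) = fun n => rightExt (16 + n) := by
    funext n
    by_cases hn : n < 32
    · interval_cases n <;> rfl
    · have e1 : n + 1 - 33 = 16 + n - 48 := by omega
      simp only [rightExt, prePer, catSeq, List.length_cons, List.length_nil, Nat.zero_add,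
        Nat.reduceAdd, e1]
      rw [if_neg (by omega), if_neg (by omega)]
  rw [CInf, cfVal_eq_add (IsDigitSeq.shift (isDigitSeq_prePer (by decide) (by decide))), hR,
    cf0_eq (isDigitSeq_prePer (by decide) (by decide))]
  rfl

lemma CInf_le : CInf ≤ ((311812017833 / 100000000000 : ℚ) : ℝ) := by
  have hR := (cfVal_mem_cfBound [1,2,2,1,1,2,2,2,2,1,2,2,1,1,2,2,2,2,1,2,2,1,1,2,2,1,2,2,2,2,1,1]
    (fun n => isDigitSeq_rightExt (16 + n)) (by decide)).1
  have hL := (cfVal_mem_cfBound [2,2,2,1,1,2,2,1,2,2,2,2,1,1,1,1,2,2,2]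
    isDigitSeq_leftTail (by decide)).1
  have hR' := one_div_le_one_div_of_le (by exact_mod_cast (cfBound_pos _).2) hR
  have hL' := one_div_le_one_div_of_le (by exact_mod_cast (cfBound_pos _).2) hL
  rw [CInf_eq]
  refine (add_le_add (add_le_add le_rfl hR') hL').trans ?_
  norm_num [cfBound]

/-- A word `l.reverse ++ d :: r` does not occur in a sequence below `C_∞` if the digit bounds
already force the value at the marked digit `d` above `C_∞`. -/
lemma IsBelowCInf.not_occurs {A : ℤ → ℕ} (hA : IsBelowCInf A) (l : List ℕ) (d : ℕ) (r : List ℕ)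
    (hbound : 311812017833 / 100000000000 ≤
      d + 1 / cfBound true r + 1 / cfBound true l) (p : ℕ)
    (hocc : ∀ i < l.length + 1 + r.length,
      A ((p + i : ℕ) : ℤ) = (l.reverse ++ d :: r).getD i 0) : False := by
  set c : ℤ := ((p + l.length : ℕ) : ℤ) with hc
  have hd : A c = d := by
    simpa [hc] using hocc l.length (by omega)
  have hR := (cfVal_mem_cfBound r (a := fun n : ℕ => A (c + 1 + n)) (fun n => hA.1 _)
    (fun i hi => by
      have := hocc (l.length + 1 + i) (by omega)
      rw [List.getD_append_right _ _ _ _ (by simp; omega)] at this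
      simp only [List.length_reverse, show l.length + 1 + i - l.length = i + 1 by omega,
        List.getD_cons_succ] at this
      rw [← this]
      congr 1
      push_cast [hc]; ring)).2
  have hL := (cfVal_mem_cfBound l (a := fun n : ℕ => A (c - 1 - n)) (fun n => hA.1 _)
    (fun i hi => by
      have := hocc (l.length - 1 - i) (by omega)
      rw [List.getD_append _ _ _ _ (by simp; omega), List.getD_eq_getElem _ _ (by simp; omega),
        List.getElem_reverse] at this
      rw [List.getD_eq_getElem _ _ hi]
      convert this using 2
      · rw [hc, show ((p + l.length : ℕ) : ℤ) = ((p + (l.length - 1 - i) : ℕ) : ℤ) + 1 + i by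
          norm_cast; omega]
        ring
      · omega)).2
  have hR' := one_div_le_one_div_of_le (cfVal_pos fun n : ℕ => hA.1 (c + 1 + n)) hR
  have hL' := one_div_le_one_div_of_le (cfVal_pos fun n : ℕ => hA.1 (c - 1 - n)) hL
  have hlt := hA.2 c
  rw [lam_eq hA.1, hd] at hlt
  have hb' : ((311812017833 / 100000000000 : ℚ) : ℝ) ≤
      ((d + 1 / cfBound true r + 1 / cfBound true l : ℚ) : ℝ) := by exact_mod_cast hbound
  push_cast at hb'
  have := CInf_le
  push_cast at this
  linarith

/-- If a sequence below `C_∞` agrees with `E` up to the end of an occurrence of a forbidden word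
with its last digit changed, then it also has this last digit in common with `E`. -/
lemma IsBelowCInf.eq_of_forbidden {A : ℤ → ℕ} (hA : IsBelowCInf A) {E : ℕ → ℕ} (l : List ℕ)
    (d : ℕ) (r : List ℕ)
    (hbound : 311812017833 / 100000000000 ≤
      d + 1 / cfBound true r + 1 / cfBound true l) (p q : ℕ)
    (hE : ∀ i, E (p + i + 6 * q) = E (p + i))
    (hword : ∀ i < l.length + 1 + r.length, (l.reverse ++ d :: r).getD i 0 =
      if i = l.length + r.length then 3 - E (p + i) else E (p + i))
    (hEN : E (p + (l.length + r.length)) = 1 ∨ E (p + (l.length + r.length)) = 2)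
    (heq : ∀ m < p + (l.length + r.length) + 6 * q, A (m : ℤ) = E m) :
    A ((p + (l.length + r.length) + 6 * q : ℕ) : ℤ) = E (p + (l.length + r.length) + 6 * q) := by
  by_contra hne
  refine hA.not_occurs l d r hbound (p + 6 * q) fun i hi => ?_
  rw [hword i hi, show p + 6 * q + i = p + i + 6 * q by ring]
  split_ifs with h
  · subst h
    rw [hE] at hne
    have := hA.1 ((p + (l.length + r.length) + 6 * q : ℕ) : ℤ)
    omega
  · rw [heq _ (by omega), hE]

lemma IsBelowCInf.cfVal_le_leftTail {B : ℤ → ℕ} (hB : IsBelowCInf B)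
    (h : ∀ m < 15, B (m : ℕ) = leftTail m) :
    cfVal (fun n => B (n : ℕ)) ≤ cfVal leftTail := by
  refine cfVal_le_cfVal_of_first_diff (fun n => hB.1 _) isDigitSeq_leftTail fun n heq hne => ?_
  have hn : 15 ≤ n := by
    by_contra hlt
    exact hne (h n (by omega))
  have hBn := hB.1 n
  obtain ⟨q, t, ht, rfl⟩ : ∃ q t, t < 6 ∧ n = 15 + t + 6 * q :=
    ⟨(n - 15) / 6, (n - 15) % 6, Nat.mod_lt _ (by norm_num), by omega⟩
  have hE : ∀ p, 13 ≤ p → ∀ i, leftTail (p + i + 6 * q) = leftTail (p + i) :=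
    fun p hp i => leftTail_add q _ (by omega)
  have good : ((15 + t) % 2 = 0 ↔ leftTail (15 + t) = 2) →
      (Even (15 + t + 6 * q) ↔ B (15 + t + 6 * q : ℕ) < leftTail (15 + t + 6 * q)) := by
    have := isDigitSeq_leftTail (15 + t)
    rw [hE 15 (by norm_num)] at hne ⊢
    rw [Nat.even_iff]
    omega
  interval_cases t
  · exact good (by decide)
  · exact good (by decide)
  · exact absurd (hB.eq_of_forbidden [1] 2 [1] (by norm_num [cfBound]) 15 q
      (hE 15 (by norm_num)) (by decide) (by decide) heq) hne
  · exact good (by decide)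
  · exact good (by decide)
  · exact absurd (hB.eq_of_forbidden [2,2,1,1] 2 [1,2] (by norm_num [cfBound]) 14 q
      (hE 14 (by norm_num)) (by decide) (by decide) heq) hne

lemma IsBelowCInf.cfVal_le_rightExt {A : ℤ → ℕ} (hA : IsBelowCInf A)
    (h : ∀ m < 32, A (m : ℕ) = rightExt m) :
    cfVal (fun n => A ((16 + n : ℕ) : ℤ)) ≤ cfVal (fun n => rightExt (16 + n)) := by
  refine cfVal_le_cfVal_of_first_diff (fun n => hA.1 _) (fun n => isDigitSeq_rightExt _)
    fun n heq hne => ?_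
  replace heq : ∀ m < 16 + n, A (m : ℕ) = rightExt m := by
    intro m hm
    by_cases hlt : m < 32
    · exact h m hlt
    · have := heq (m - 16) (by omega)
      rwa [show 16 + (m - 16) = m by omega] at this
  rw [show Even n ↔ Even (16 + n) by
    rw [Nat.even_iff, Nat.even_iff]; omega]
  generalize 16 + n = N at heq hne ⊢
  have hN : 32 ≤ N := by
    by_contra hlt
    exact hne (h N (by omega))
  have hAN := hA.1 N
  have good : (Even N ↔ rightExt N = 2) → (Even N ↔ A N < rightExt N) := by
    have := isDigitSeq_rightExt N
    intro hpar
    rw [hpar]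
    omega
  by_cases hlt : N < 48
  · interval_cases N
    · exact good (by decide)
    · exact absurd (hA.eq_of_forbidden [2,2,2,1,1,2,2,1] 2
        [1,2,2,1,1,2,2,2,1] (by norm_num [cfBound]) 16 0 (fun _ => rfl) (by decide) (by decide)
        heq) hne
    · exact absurd (hA.eq_of_forbidden [2,2,2,1,1,2,2,1,2,2] 2
        [1,2,2,1,1,2,2,2,2,2] (by norm_num [cfBound]) 14 0 (fun _ => rfl) (by decide) (by decide)
        heq) hne
    · exact absurd (hA.eq_of_forbidden [2,2,2,1,1,2,2,1,2,2] 2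
        [1,2,2,1,1,2,2,2,2,1,1] (by norm_num [cfBound]) 14 0 (fun _ => rfl) (by decide) (by decide)
        heq) hne
    · exact good (by decide)
    · exact good (by decide)
    · exact absurd (hA.eq_of_forbidden [2,2,2,1,1,2,2,1,2,2,2,2] 2
        [1,2,2,1,1,2,2,2,2,1,2,2,1,2] (by norm_num [cfBound]) 12 0 (fun _ => rfl) (by decide) (by decide)
        heq) hne
    · exact absurd (hA.eq_of_forbidden [2,2,2,1,1,2,2,1,2,2,2,2,1,1,2,2] 2
        [1,2,2,1,1,2,2,2,2,1,2,2,1,1,1] (by norm_num [cfBound]) 8 0 (fun _ => rfl) (by decide) (by decide)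
        heq) hne
    · exact good (by decide)
    · exact good (by decide)
    · exact good (by decide)
    · exact absurd (hA.eq_of_forbidden [1] 2
        [1] (by norm_num [cfBound]) 41 0 (fun _ => rfl) (by decide) (by decide)
        heq) hne
    · exact good (by decide)
    · exact absurd (hA.eq_of_forbidden [1,2,2,1] 2
        [2,2,1] (by norm_num [cfBound]) 38 0 (fun _ => rfl) (by decide) (by decide)
        heq) hne
    · exact absurd (hA.eq_of_forbidden [1,2,2,1,1,2] 2
        [2,2,2,2] (by norm_num [cfBound]) 36 0 (fun _ => rfl) (by decide) (by decide)
        heq) hne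
    · exact good (by decide)
  · obtain ⟨q, t, ht, rfl⟩ : ∃ q t, t < 6 ∧ N = 48 + t + 6 * q :=
      ⟨(N - 48) / 6, (N - 48) % 6, Nat.mod_lt _ (by norm_num), by omega⟩
    have hE : ∀ p, 46 ≤ p → ∀ i, rightExt (p + i + 6 * q) = rightExt (p + i) :=
      fun p hp i => rightExt_add q _ (by omega)
    have good' : ((48 + t) % 2 = 0 ↔ rightExt (48 + t) = 2) →
        (Even (48 + t + 6 * q) ↔ A (48 + t + 6 * q : ℕ) < rightExt (48 + t + 6 * q)) := by
      intro hpar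
      apply good
      rw [hE 48 (by norm_num), Nat.even_iff]
      omega
    interval_cases t
    · exact good' (by decide)
    · exact absurd (hA.eq_of_forbidden [1] 2 [1] (by norm_num [cfBound]) 47 q
        (hE 47 (by norm_num)) (by decide) (by decide) heq) hne
    · exact good' (by decide)
    · exact good' (by decide)
    · exact absurd (hA.eq_of_forbidden [2,2,1,1] 2 [1,2] (by norm_num [cfBound]) 46 q
        (hE 46 (by norm_num)) (by decide) (by decide) heq) hne
    · exact good' (by decide)

lemma IsBelowCInf.not_occursInZ_bigWord13 {A : ℤ → ℕ} (hA : IsBelowCInf A) :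
    ¬ occursInZ bigWord13 A := by
  rintro ⟨j, hj⟩
  have hR := (hA.translate j).cfVal_le_rightExt (by
    intro m hm
    rw [hj m hm]
    interval_cases m <;> rfl)
  have hL := (hA.reflect (j + 14)).cfVal_le_leftTail (by
    intro m hm
    have := hj (14 - m) (by simp [bigWord13, bigWord]; omega)
    rw [show j + 14 - (m : ℤ) = j + (14 - m : ℕ) by omega, this]
    interval_cases m <;> rfl)
  have hlt := hA.2 (j + 15)
  have hd : A (j + 15) = 2 := hj 15 (by decide)
  have e1 : (fun n : ℕ => A (j + 15 + 1 + n)) = fun n : ℕ => A (j + (16 + n : ℕ)) := by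
    funext n; congr 1; push_cast; ring
  have e2 : (fun n : ℕ => A (j + 15 - 1 - n)) = fun n : ℕ => A (j + 14 - n) := by
    funext n; congr 1; ring
  rw [lam_eq hA.1, hd, e1, e2, CInf_eq] at hlt
  have hR' := one_div_le_one_div_of_le (cfVal_pos fun n => hA.1 _) hR
  have hL' := one_div_le_one_div_of_le (cfVal_pos fun n => hA.1 _) hL
  push_cast at hlt hR'
  linarith

/-- the word `1_3 2_4 1 2_2 1_2 2_4 1 2_2 1_2 2_4 1 2_2 1_2 2_2` and its
transpose do not occur in a bi-infinite sequence with Markov value `< C_∞`. -/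
theorem no_bigWord13 (A : ℤ → ℕ) (hA : ∀ n, A n = 1 ∨ A n = 2)
    (hb : BddAbove (Set.range (lam A))) (hm : markovVal A < CInf) :
    ¬ occursInZ bigWord13 A ∧ ¬ occursInZ bigWord13.reverse A := by
  have hlow : IsBelowCInf A :=
    ⟨hA, fun i => (le_csSup hb (Set.mem_range_self i)).trans_lt hm⟩
  refine ⟨hlow.not_occursInZ_bigWord13, ?_⟩
  rintro ⟨j, hj⟩
  refine (hlow.reflect (j + 31)).not_occursInZ_bigWord13 ⟨0, fun i hi => ?_⟩
  have hi' : i < 32 := hi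
  have := hj (31 - i) (by simp [bigWord13, bigWord]; omega)
  simp only [zero_add]
  rw [show j + 31 - (i : ℤ) = j + (31 - i : ℕ) by omega, this]
  interval_cases i <;> rfl
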